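/- Let F be a field, let n be a positive integer, and for 1 ≤ i ≤ n let A_i be a nonempty finite subset of F with a_i = #A_i; put A = Π_{i=1}^n A_i. Let P ∈ F[t_1,…,t_n] be a nonzero polynomial, and let u_A = #{x ∈ A : P(x) ≠ 0}. Then u_A = 0 or u_A ≥ m(a_1,…,a_n; a_1 + … + a_n − deg P). -/

import Mathlib

/-- The balls-in-bins quantity `m(a₁,…,a_n; N)`: the minimum of `y₁⋯y_n` over all
integer tuples with `1 ≤ y_i ≤ a_i` and `∑ y_i = N` when `n ≤ N ≤ ∑ a_i`; extended by
`1` for `N < n` and by `∏ a_i` for `N > ∑ a_i`. -/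
noncomputable def mBB (n : ℕ) (a : Fin n → ℕ) (N : ℤ) : ℕ :=
  if N < (n : ℤ) then 1
  else if (∑ i, (a i : ℤ)) < N then ∏ i, a i
  else sInf {P : ℕ | ∃ y : Fin n → ℕ,
    (∀ i, 1 ≤ y i ∧ y i ≤ a i) ∧ (∑ i, (y i : ℤ)) = N ∧ P = ∏ i, y i}

namespace MvPolynomial

variable {σ F : Type*} [Field F] [DecidableEq σ]

/-- Division with remainder of a monomial by `X i - C c`, with control of the degree. -/
lemma exists_sub_mul_add_eval_update_monomial (i : σ) (c : F) (s : σ →₀ ℕ) (a : F) :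
    ∃ Q : MvPolynomial σ F,
      (Q = 0 ∨ Q.totalDegree + 1 ≤ (monomial s a).totalDegree) ∧
      ∀ x : σ → F, eval x (monomial s a) =
        (x i - c) * eval x Q + eval (Function.update x i c) (monomial s a) := by
  refine induction_on_monomial (motive := fun p => ∃ Q : MvPolynomial σ F,
      (Q = 0 ∨ Q.totalDegree + 1 ≤ p.totalDegree) ∧
      ∀ x : σ → F, eval x p = (x i - c) * eval x Q + eval (Function.update x i c) p)
    (fun a => ⟨0, Or.inl rfl, by simp⟩) ?_ s a
  rintro p j ⟨Q, hQ, hev⟩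
  by_cases hp : p = 0
  · exact ⟨0, Or.inl rfl, by simp [hp]⟩
  rw [totalDegree_mul_of_isDomain hp (X_ne_zero j), totalDegree_X]
  by_cases hj : j = i
  · subst hj
    refine ⟨p + C c * Q, Or.inr ?_, fun x => ?_⟩
    · have h1 := totalDegree_add p (C c * Q)
      have h2 := totalDegree_mul (C c) Q
      rw [totalDegree_C] at h2
      rcases hQ with rfl | hQ
      · simp
      · have : max p.totalDegree (C c * Q).totalDegree ≤ p.totalDegree := by
          rw [max_le_iff]; omega
        omega
    · have h := hev x
      simp only [map_mul, map_add, eval_X, eval_C, Function.update_self]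
      linear_combination c * h
  · refine ⟨Q * X j, ?_, fun x => ?_⟩
    · rcases hQ with rfl | hQ
      · simp
      · right
        have h2 := totalDegree_mul Q (X j)
        rw [totalDegree_X] at h2
        omega
    · have h := hev x
      simp only [map_mul, eval_X, Function.update_of_ne hj]
      linear_combination x j * h

/-- Division with remainder by `X i - C c`, with control of the degree of the quotient. -/
lemma exists_sub_mul_add_eval_update (i : σ) (c : F) (P : MvPolynomial σ F) :
    ∃ Q : MvPolynomial σ F, (Q = 0 ∨ Q.totalDegree + 1 ≤ P.totalDegree) ∧
      ∀ x : σ → F, eval x P = (x i - c) * eval x Q + eval (Function.update x i c) P := by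
  choose Q hQ hev using fun s =>
    exists_sub_mul_add_eval_update_monomial i c s (P.coeff s)
  have hdeg : ∀ s ∈ P.support, Q s = 0 ∨ (Q s).totalDegree + 1 ≤ P.totalDegree := by
    intro s hs
    refine (hQ s).imp_right fun h => h.trans ?_
    rw [totalDegree_monomial _ (mem_support_iff.mp hs)]
    exact le_totalDegree hs
  refine ⟨∑ s ∈ P.support, Q s, ?_, fun x => ?_⟩
  · by_cases hd : P.totalDegree = 0
    · left
      refine Finset.sum_eq_zero fun s hs => (hdeg s hs).resolve_right ?_
      omega
    · right
      have : (∑ s ∈ P.support, Q s).totalDegree ≤ P.totalDegree - 1 := by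
        refine totalDegree_finsetSum_le fun s hs => ?_
        rcases hdeg s hs with h | h
        · simp [h]
        · omega
      omega
  · have key : ∀ z : σ → F, eval z P =
        ∑ s ∈ P.support, eval z (monomial s (P.coeff s)) := fun z => by
      conv_lhs => rw [P.as_sum, map_sum]
    rw [key x, key (Function.update x i c), map_sum, Finset.mul_sum,
      ← Finset.sum_add_distrib]
    exact Finset.sum_congr rfl fun s _ => hev s x

variable [Fintype σ] [DecidableEq F]

/-- If `P` does not vanish identically on the grid `∏ A i`, then its number of nonzeros there is
at least `∏ y i` for some `1 ≤ y i ≤ #(A i)` with `∑ y i ≥ ∑ #(A i) - deg P`. -/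
lemma exists_prod_le_card_eval_ne_zero (A : σ → Finset F) (P : MvPolynomial σ F)
    (h : ∃ x ∈ Fintype.piFinset A, eval x P ≠ 0) :
    ∃ y : σ → ℕ, (∀ i, 1 ≤ y i ∧ y i ≤ (A i).card) ∧
      ∑ i, (A i).card ≤ ∑ i, y i + P.totalDegree ∧
      ∏ i, y i ≤ ((Fintype.piFinset A).filter fun x => eval x P ≠ 0).card := by
  induction hk : ∑ i, (A i).card using Nat.strong_induction_on generalizing A P with
  | _ k ih =>
  subst hk
  obtain ⟨x₀, hx₀, hPx₀⟩ := h
  have hx₀' := Fintype.mem_piFinset.mp hx₀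
  have hcard : ∀ (i : σ) (B : Finset F),
      ∑ j, (Function.update A i B j).card + (A i).card = ∑ j, (A j).card + B.card := by
    intro i B
    rw [← Finset.add_sum_erase _ _ (Finset.mem_univ i),
      ← Finset.add_sum_erase _ (fun j => (A j).card) (Finset.mem_univ i),
      Finset.sum_congr (g := fun j => (A j).card) rfl fun j hj => by
        rw [Function.update_of_ne (Finset.ne_of_mem_erase hj)]]
    simp only [Function.update_self]
    omega
  have hsub : ∀ (i : σ) (B : Finset F), B ⊆ A i →
      ∀ x ∈ Fintype.piFinset (Function.update A i B), x ∈ Fintype.piFinset A ∧ x i ∈ B := by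
    intro i B hB x hx
    rw [Fintype.mem_piFinset] at hx ⊢
    have hi : x i ∈ B := by simpa using hx i
    refine ⟨fun j => ?_, hi⟩
    by_cases hj : j = i
    · subst hj; exact hB hi
    · simpa [hj] using hx j
  have hsup : ∀ (i : σ) (B : Finset F), ∀ x ∈ Fintype.piFinset A, x i ∈ B →
      x ∈ Fintype.piFinset (Function.update A i B) := by
    intro i B x hx hi
    rw [Fintype.mem_piFinset] at hx ⊢
    intro j
    by_cases hj : j = i
    · subst hj; simpa using hi
    · simpa [hj] using hx j
  by_cases hslice : ∃ i, ∃ c ∈ A i, ∀ x ∈ Fintype.piFinset A, x i = c → eval x P = 0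
  · obtain ⟨i, c, hc, hzero⟩ := hslice
    obtain ⟨Q, hQ, hev⟩ := exists_sub_mul_add_eval_update i c P
    have hPQ : ∀ x ∈ Fintype.piFinset A, eval x P = (x i - c) * eval x Q := by
      intro x hx
      rw [hev x, hzero (Function.update x i c) _ (Function.update_self ..), add_zero]
      rw [Fintype.mem_piFinset] at hx ⊢
      intro j
      by_cases hj : j = i
      · subst hj; simpa using hc
      · simpa [hj] using hx j
    have hx₀Q := hPx₀
    rw [hPQ x₀ hx₀] at hx₀Q
    have hQdeg : Q.totalDegree + 1 ≤ P.totalDegree :=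
      hQ.resolve_left (by rintro rfl; simp at hx₀Q)
    have hsum := hcard i ((A i).erase c)
    have hAi := Finset.card_erase_add_one hc
    obtain ⟨y, hy, hys, hyp⟩ := ih _ (by omega) (Function.update A i ((A i).erase c)) Q
      ⟨x₀, hsup i _ x₀ hx₀ (Finset.mem_erase.mpr
        ⟨sub_ne_zero.mp (left_ne_zero_of_mul hx₀Q), hx₀' i⟩),
        right_ne_zero_of_mul hx₀Q⟩ rfl
    refine ⟨y, fun j => ⟨(hy j).1, ?_⟩, by omega, hyp.trans (Finset.card_le_card ?_)⟩
    · have := (hy j).2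
      by_cases hj : j = i
      · subst hj
        rw [Function.update_self] at this
        omega
      · rwa [Function.update_of_ne hj] at this
    · intro x hx
      rw [Finset.mem_filter] at hx ⊢
      obtain ⟨hxA, hxi⟩ := hsub i _ (Finset.erase_subset _ _) x hx.1
      refine ⟨hxA, ?_⟩
      rw [hPQ x hxA]
      exact mul_ne_zero (sub_ne_zero.mpr (Finset.ne_of_mem_erase hxi)) hx.2
  · push Not at hslice
    by_cases hone : ∀ i, (A i).card ≤ 1
    · refine ⟨fun _ => 1, fun i => ⟨le_rfl, Finset.card_pos.mpr ⟨_, hx₀' i⟩⟩,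
        (Finset.sum_le_sum fun i _ => hone i).trans (Nat.le_add_right _ _), ?_⟩
      simpa using Finset.card_pos.mpr ⟨x₀, Finset.mem_filter.mpr ⟨hx₀, hPx₀⟩⟩
    · push Not at hone
      obtain ⟨i, hi⟩ := hone
      obtain ⟨c, hc, hmin⟩ := Finset.exists_min_image (A i)
        (fun c => (((Fintype.piFinset A).filter fun x => eval x P ≠ 0).filter
          fun x => x i = c).card) ⟨_, hx₀' i⟩
      obtain ⟨x₁, hx₁, hx₁c, hPx₁⟩ := hslice i c hc
      have hsum := hcard i {c}
      rw [Finset.card_singleton] at hsum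
      obtain ⟨y, hy, hys, hyp⟩ := ih _ (by omega) (Function.update A i {c}) P
        ⟨x₁, hsup i _ x₁ hx₁ (by simp [hx₁c]), hPx₁⟩ rfl
      have hyi : y i = 1 := by
        have := hy i
        rw [Function.update_self, Finset.card_singleton] at this
        omega
      have hfib : ((Fintype.piFinset (Function.update A i {c})).filter
          fun x => eval x P ≠ 0).card ≤ (((Fintype.piFinset A).filter
            fun x => eval x P ≠ 0).filter fun x => x i = c).card := by
        refine Finset.card_le_card fun x hx => ?_
        rw [Finset.mem_filter] at hx
        obtain ⟨hxA, hxi⟩ := hsub i _ (Finset.singleton_subset_iff.mpr hc) x hx.1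
        simp only [Finset.mem_filter]
        exact ⟨⟨hxA, hx.2⟩, Finset.mem_singleton.mp hxi⟩
      refine ⟨Function.update y i (A i).card, fun j => ?_, ?_, ?_⟩
      · by_cases hj : j = i
        · subst hj
          rw [Function.update_self]
          omega
        · have := hy j
          rwa [Function.update_of_ne hj] at this ⊢
      · rw [Finset.sum_update_of_mem (Finset.mem_univ i), Finset.sdiff_singleton_eq_erase]
        have := Finset.add_sum_erase _ y (Finset.mem_univ i)
        omega
      · have hprod : ∏ j, Function.update y i (A i).card j = (A i).card * ∏ j, y j := by
          rw [Finset.prod_update_of_mem (Finset.mem_univ i), Finset.sdiff_singleton_eq_erase,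
            ← Finset.mul_prod_erase _ y (Finset.mem_univ i), hyi, one_mul]
        rw [hprod, Finset.card_eq_sum_card_fiberwise (f := fun x => x i) (t := A i)
          fun x hx => Fintype.mem_piFinset.mp (Finset.mem_filter.mp hx).1 i, ← smul_eq_mul]
        exact Finset.card_nsmul_le_sum _ _ _ fun d hd => (hyp.trans hfib).trans (hmin d hd)

end MvPolynomial

/-- A tuple of positive integers can be shrunk, keeping positivity, to any smaller sum. -/
lemma exists_le_sum_eq_of_one_le {ι : Type*} [Fintype ι] [DecidableEq ι] (N : ℕ)
    (hN : Fintype.card ι ≤ N) (y : ι → ℕ) (hy : ∀ i, 1 ≤ y i) (hNy : N ≤ ∑ i, y i) :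
    ∃ z : ι → ℕ, (∀ i, 1 ≤ z i ∧ z i ≤ y i) ∧ ∑ i, z i = N := by
  induction N, hN using Nat.le_induction with
  | base => exact ⟨fun _ => 1, fun i => ⟨le_rfl, hy i⟩, by simp⟩
  | succ N _ ih =>
    obtain ⟨z, hz, hzs⟩ := ih (by omega)
    obtain ⟨i, -, hi⟩ := Finset.exists_lt_of_sum_lt (s := Finset.univ) (f := z) (g := y)
      (by omega)
    refine ⟨Function.update z i (z i + 1), fun j => ?_, ?_⟩
    · by_cases hj : j = i
      · subst hj
        rw [Function.update_self]
        omega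
      · rw [Function.update_of_ne hj]
        exact hz j
    · rw [Finset.sum_update_of_mem (Finset.mem_univ i), Finset.sdiff_singleton_eq_erase]
      have := Finset.add_sum_erase _ z (Finset.mem_univ i)
      omega

/-- `mBB n a N` is at most `∏ y i` as soon as `1 ≤ y i ≤ a i` and `N ≤ ∑ y i`. -/
lemma mBB_le_prod {n : ℕ} {a y : Fin n → ℕ} {N : ℤ} (hy : ∀ i, 1 ≤ y i ∧ y i ≤ a i)
    (hN : N ≤ ∑ i, (y i : ℤ)) : mBB n a N ≤ ∏ i, y i := by
  unfold mBB
  have hya : ∑ i, (y i : ℤ) ≤ ∑ i, (a i : ℤ) :=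
    Finset.sum_le_sum fun i _ => by exact_mod_cast (hy i).2
  rw [if_neg (show ¬ ∑ i, (a i : ℤ) < N by omega)]
  split_ifs with h
  · exact Nat.one_le_iff_ne_zero.mpr
      (Finset.prod_ne_zero_iff.mpr fun i _ => Nat.one_le_iff_ne_zero.mp (hy i).1)
  · lift N to ℕ using by omega
    obtain ⟨z, hz, hzs⟩ := exists_le_sum_eq_of_one_le N (by simpa using h) y
      (fun i => (hy i).1) (by exact_mod_cast hN)
    have hzy : ∏ i, z i ≤ ∏ i, y i := Finset.prod_le_prod' fun i _ => (hz i).2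
    refine le_trans (Nat.sInf_le ?_) hzy
    exact ⟨z, fun i => ⟨(hz i).1, (hz i).2.trans (hy i).2⟩, by exact_mod_cast hzs, rfl⟩

/-- **Alon–Füredi Theorem**: for a nonzero polynomial `P` over a field `F` and finite
nonempty sets `A_i ⊆ F`, the number `u` of points of `A = ∏ A_i` where `P` does not
vanish satisfies `u = 0` or `u ≥ m(a₁,…,a_n; a₁+⋯+a_n - deg P)`. -/
theorem alon_furedi
    {F : Type*} [Field F] (n : ℕ) (hn : 0 < n)
    (A : Fin n → Finset F) (hA : ∀ i, (A i).Nonempty)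
    (P : MvPolynomial (Fin n) F) (hP : P ≠ 0) :
    Set.ncard {x : Fin n → F | (∀ i, x i ∈ A i) ∧ MvPolynomial.eval x P ≠ 0} = 0 ∨
      mBB n (fun i => (A i).card)
        ((∑ i, ((A i).card : ℤ)) - (P.totalDegree : ℤ)) ≤
        Set.ncard {x : Fin n → F | (∀ i, x i ∈ A i) ∧ MvPolynomial.eval x P ≠ 0} := by
  classical
  have hset : {x : Fin n → F | (∀ i, x i ∈ A i) ∧ MvPolynomial.eval x P ≠ 0} =
      ((Fintype.piFinset A).filter fun x => MvPolynomial.eval x P ≠ 0 : Finset (Fin n → F)) := by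
    ext x
    simp
  rw [hset, Set.ncard_coe_finset]
  refine or_iff_not_imp_left.mpr fun h => ?_
  obtain ⟨x, hx⟩ := Finset.card_ne_zero.mp h
  obtain ⟨y, hy, hys, hyp⟩ := MvPolynomial.exists_prod_le_card_eval_ne_zero A P
    ⟨x, Finset.mem_filter.mp hx⟩
  refine (mBB_le_prod hy ?_).trans hyp
  rw [sub_le_iff_le_add]
  exact_mod_cast hys
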